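/- Let g ≥ 3 and C > 0. There exist constants c = c(C,g) > 0 and K_0 = K_0(C,g) such that the following holds for all integers K ≥ K_0. Let k be an integer with 0 ≤ k ≤ (g−1)K and set ξ := k − μ_K. Let L, R be positive integers with (3/2)·log_g K ≤ R ≤ L and max(|ξ|, LR) ≤ C·K^{1/4}. Then for every real θ with w_K((g−1)θ) ≤ L and ‖(g−1)θ‖_{ℝ/ℤ} ≥ g^{−K+2LR}, one has |Σ_{n < g^K, s_g(n) = k} e(nθ)| ≤ c · g^K (|ξ| + LR)² K^{−3/2}. -/

import Mathlib

set_option autoImplicit false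

noncomputable section

/-- `e(x) = exp(2πix)`. -/
def eC (x : ℝ) : ℂ := Complex.exp (2 * Real.pi * Complex.I * x)

/-- Base-`g` digit sum. -/
def digitSum (g n : ℕ) : ℕ := (Nat.digits g n).sum

/-- `S_g(k)`: naturals below `g^K` with base-`g` digit sum `k`. -/
def Sset (g K : ℕ) (k : ℤ) : Finset ℕ :=
  (Finset.range (g ^ K)).filter fun n => (digitSum g n : ℤ) = k

/-- The average digit sum `μ_K = (g-1)K/2`. -/
def muK (g K : ℕ) : ℝ := ((g : ℝ) - 1) * K / 2

/-- Distance to the nearest integer. -/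
def distToInt (x : ℝ) : ℝ := |x - round x|

/-- Left endpoint of the fundamental interval for the centred base-`g` expansion:
`-1/2` for odd `g` and `-(g-2)/(2(g-1))` for even `g`. -/
def Lg (g : ℕ) : ℝ :=
  if g % 2 = 1 then -(1 / 2) else -(((g : ℝ) - 2) / (2 * ((g : ℝ) - 1)))

/-- The `i`-th digit (`i ≥ 1`) of the centred base-`g` expansion of (the representative
modulo 1 of) `α`, chosen so that ambiguous expansions end in the minimal digit. -/
def centredDigit (g : ℕ) (α : ℝ) (i : ℕ) : ℤ :=
  ⌊(g : ℝ) ^ i * α - Lg g⌋ - g * ⌊(g : ℝ) ^ (i - 1) * α - Lg g⌋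

/-- `w_K(α)`: the number of nonzero digits among the first `K` digits of the centred
base-`g` expansion of `α`. -/
def wK (g K : ℕ) (α : ℝ) : ℕ :=
  ((Finset.Icc 1 K).filter fun i => centredDigit g α i ≠ 0).card

theorem eC_eq_exp_I_mul (x : ℝ) : eC x = Complex.exp (Complex.I * ((2 * Real.pi * x : ℝ) : ℂ)) := by
  unfold eC; congr 1; push_cast; ring

theorem eC_add (x y : ℝ) : eC (x + y) = eC x * eC y := by
  unfold eC; rw [← Complex.exp_add]; congr 1; push_cast; ring

theorem eC_zero : eC 0 = 1 := by simp [eC]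

theorem norm_eC (x : ℝ) : ‖eC x‖ = 1 := by
  rw [eC_eq_exp_I_mul, mul_comm]; exact Complex.norm_exp_ofReal_mul_I _

theorem eC_int (n : ℤ) : eC n = 1 := by
  unfold eC
  rw [Complex.exp_eq_one_iff]
  exact ⟨n, by push_cast; ring⟩

theorem eC_add_int (x : ℝ) (n : ℤ) : eC (x + n) = eC x := by
  rw [eC_add, eC_int, mul_one]

theorem eC_sub_int (x : ℝ) (n : ℤ) : eC (x - n) = eC x := by
  rw [← eC_add_int (x - n) n, sub_add_cancel]

theorem continuous_eC : Continuous eC := by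
  unfold eC; fun_prop

theorem eC_nat_mul (n : ℕ) (x : ℝ) : eC (n * x) = eC x ^ n := by
  unfold eC; rw [← Complex.exp_nat_mul]; congr 1; push_cast; ring

theorem distToInt_nonneg (x : ℝ) : 0 ≤ distToInt x := abs_nonneg _

theorem distToInt_le_abs_sub (x : ℝ) (n : ℤ) : distToInt x ≤ |x - n| := round_le x n

theorem norm_eC_sub_one_le (x : ℝ) : ‖eC x - 1‖ ≤ 2 * Real.pi * |x| := by
  rw [eC_eq_exp_I_mul]
  refine Real.norm_exp_I_mul_ofReal_sub_one_le.trans (le_of_eq ?_)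
  rw [Real.norm_eq_abs, abs_mul, abs_of_pos (by positivity)]

theorem norm_eC_natCast_mul_sub_one_le (d : ℕ) (x : ℝ) :
    ‖eC (d * x) - 1‖ ≤ 2 * Real.pi * (d * distToInt x) := by
  have h : eC (d * x) = eC (d * (x - round x)) := by
    rw [← eC_sub_int (d * x) (d * round x)]; congr 1; push_cast; ring
  rw [h]
  refine (norm_eC_sub_one_le _).trans (le_of_eq ?_)
  rw [abs_mul, abs_of_nonneg (Nat.cast_nonneg (α := ℝ) d)]; rfl

theorem le_norm_eC_sub_one (x : ℝ) : 4 * distToInt x ≤ ‖eC x - 1‖ := by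
  rw [← eC_sub_int x (round x), eC_eq_exp_I_mul, Complex.norm_exp_I_mul_ofReal_sub_one]
  have hx := abs_sub_round x
  have hpi := Real.pi_pos
  have e : 2 * Real.pi * (x - round x) / 2 = Real.pi * (x - round x) := by ring
  rw [e, Real.norm_eq_abs, abs_mul, abs_of_pos (by norm_num : (0 : ℝ) < 2)]
  have h := Real.mul_abs_le_abs_sin (x := Real.pi * (x - round x)) (by
    rw [abs_mul, abs_of_pos hpi]; nlinarith)
  rw [abs_mul, abs_of_pos hpi] at h
  have h2 : 2 / Real.pi * (Real.pi * |x - round x|) = 2 * |x - round x| := by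
    field_simp
  rw [h2] at h
  unfold distToInt
  linarith

theorem norm_sum_eC_mul_le (N : ℕ) (x : ℝ) :
    ‖∑ n ∈ Finset.range N, eC (n * x)‖ * (2 * distToInt x) ≤ 1 := by
  have h : (∑ n ∈ Finset.range N, eC (n * x)) * (eC x - 1) = eC (N * x) - 1 := by
    simp_rw [eC_nat_mul]
    exact geom_sum_mul _ _
  have h1 : ‖eC (N * x) - 1‖ ≤ 2 := by
    refine (norm_sub_le _ _).trans ?_
    rw [norm_eC, norm_one]; norm_num
  rw [← h, norm_mul] at h1
  have h2 := le_norm_eC_sub_one x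
  have h3 := mul_le_mul_of_nonneg_left h2 (norm_nonneg (∑ n ∈ Finset.range N, eC (n * x)))
  linarith

theorem norm_one_add_eC_le (x : ℝ) : ‖1 + eC x‖ ≤ 2 - 4 * distToInt x ^ 2 := by
  rw [← eC_sub_int x (round x)]
  unfold distToInt
  set y := x - round x with hy
  have hyb : |y| ≤ 1 / 2 := abs_sub_round x
  have hpi := Real.pi_pos
  have e : 1 + eC y = eC (y / 2) * ((2 * Real.cos (Real.pi * y) : ℝ) : ℂ) := by
    push_cast
    rw [Complex.two_cos]
    unfold eC
    rw [mul_add, ← Complex.exp_add, ← Complex.exp_add, add_comm]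
    congr 1
    · congr 1; push_cast; ring
    · rw [← Complex.exp_zero]; congr 1; push_cast; ring
  have hcos : 0 ≤ Real.cos (Real.pi * y) := by
    apply Real.cos_nonneg_of_mem_Icc
    rw [abs_le] at hyb
    constructor <;> nlinarith [hyb.1, hyb.2]
  rw [e, norm_mul, norm_eC, one_mul, Complex.norm_real, Real.norm_eq_abs,
    abs_of_nonneg (by positivity)]
  have h := Real.cos_le_one_sub_mul_cos_sq (x := Real.pi * y) (by
    rw [abs_mul, abs_of_pos hpi]; nlinarith)
  have h2 : 2 / Real.pi ^ 2 * (Real.pi * y) ^ 2 = 2 * y ^ 2 := by field_simp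
  rw [h2] at h
  rw [sq_abs]
  linarith

/-- A centred one-digit exponential sum: the factor contributed by a digit with phase `x` per unit,
twisted by the deviation of the digit from its mean. -/
def digitFactor (g : ℕ) (x t : ℝ) : ℂ :=
  ∑ d ∈ Finset.range g, eC (d * x + (d - ((g : ℝ) - 1) / 2) * t)

theorem continuous_digitFactor (g : ℕ) (x : ℝ) : Continuous (digitFactor g x) := by
  unfold digitFactor
  exact continuous_finsetSum _ fun d _ => continuous_eC.comp (by fun_prop)

theorem norm_digitFactor_le_exp {g : ℕ} (hg : 2 ≤ g) (x t : ℝ) :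
    ‖digitFactor g x t‖ ≤ g * Real.exp (-(4 / g * distToInt (x + t) ^ 2)) := by
  have e : digitFactor g x t =
      eC (-(((g : ℝ) - 1) / 2 * t)) * ∑ d ∈ Finset.range g, eC (d * (x + t)) := by
    unfold digitFactor
    rw [Finset.mul_sum]
    refine Finset.sum_congr rfl fun d _ => ?_
    rw [← eC_add]; congr 1; ring
  rw [e, norm_mul, norm_eC, one_mul]
  obtain ⟨m, rfl⟩ : ∃ m, g = 2 + m := ⟨g - 2, by omega⟩
  rw [Finset.sum_range_add, Finset.sum_range_succ, Finset.sum_range_one]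
  have h1 : ‖∑ i ∈ Finset.range m, eC (((2 + i : ℕ) : ℝ) * (x + t))‖ ≤ m := by
    refine (norm_sum_le _ _).trans (le_of_eq ?_)
    simp [norm_eC]
  have h2 := norm_one_add_eC_le (x + t)
  have h3 : eC (((0 : ℕ) : ℝ) * (x + t)) + eC (((1 : ℕ) : ℝ) * (x + t)) = 1 + eC (x + t) := by
    simp [eC_zero]
  rw [h3]
  refine (norm_add_le _ _).trans ?_
  have hpos : (0 : ℝ) < ((2 + m : ℕ) : ℝ) := by positivity
  have h4 := Real.add_one_le_exp (-(4 / ((2 + m : ℕ) : ℝ) * distToInt (x + t) ^ 2))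
  have h5 := mul_le_mul_of_nonneg_left h4 hpos.le
  have h6 : ((2 + m : ℕ) : ℝ) * (-(4 / ((2 + m : ℕ) : ℝ) * distToInt (x + t) ^ 2) + 1)
      = 2 + m - 4 * distToInt (x + t) ^ 2 := by
    field_simp; push_cast; ring
  rw [h6] at h5
  linarith

theorem norm_digitFactor_le (g : ℕ) (x t : ℝ) : ‖digitFactor g x t‖ ≤ g := by
  refine (norm_sum_le _ _).trans (le_of_eq ?_)
  simp [norm_eC]

theorem norm_digitFactor_sub_le (g : ℕ) (x t : ℝ) :
    ‖digitFactor g x t - digitFactor g 0 t‖ ≤ g * (2 * Real.pi * (g * distToInt x)) := by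
  unfold digitFactor
  rw [← Finset.sum_sub_distrib]
  refine (norm_sum_le _ _).trans ?_
  refine (Finset.sum_le_card_nsmul _ _ (2 * Real.pi * (g * distToInt x)) ?_).trans (by simp)
  intro d hd
  rw [mul_zero, zero_add, eC_add]
  have e : eC (d * x) * eC ((d - ((g : ℝ) - 1) / 2) * t) - eC ((d - ((g : ℝ) - 1) / 2) * t)
    = (eC (d * x) - 1) * eC ((d - ((g : ℝ) - 1) / 2) * t) := by ring
  rw [e, norm_mul, norm_eC, mul_one]
  refine (norm_eC_natCast_mul_sub_one_le d x).trans ?_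
  have hd' : (d : ℝ) ≤ g := by exact_mod_cast (Finset.mem_range.1 hd).le
  have := distToInt_nonneg x
  gcongr

theorem digitFactor_zero_neg (g : ℕ) (t : ℝ) : digitFactor g 0 (-t) = digitFactor g 0 t := by
  unfold digitFactor
  rw [← Finset.sum_range_reflect]
  refine Finset.sum_congr rfl fun d hd => ?_
  have hd := Finset.mem_range.1 hd
  rw [Nat.cast_sub (by omega), Nat.cast_sub (by omega)]
  congr 1; push_cast; ring

theorem digitSum_mul_add {g : ℕ} (hg : 2 ≤ g) (m d : ℕ) (hd : d < g) :
    digitSum g (m * g + d) = d + digitSum g m := by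
  unfold digitSum
  by_cases h : d ≠ 0 ∨ m ≠ 0
  · rw [mul_comm, add_comm, Nat.digits_add g (by omega) d m hd h, List.sum_cons]
  · push Not at h
    simp [h.1, h.2]

theorem sum_range_mul_eq {M : Type*} [AddCommMonoid M] (g N : ℕ) (f : ℕ → M) :
    ∑ n ∈ Finset.range (N * g), f n =
      ∑ m ∈ Finset.range N, ∑ d ∈ Finset.range g, f (m * g + d) := by
  induction N with
  | zero => simp
  | succ N ih => rw [Nat.succ_mul, Finset.sum_range_add, ih, Finset.sum_range_succ]

theorem prod_digitFactor {g : ℕ} (hg : 2 ≤ g) (K : ℕ) (θ β t : ℝ) :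
    ∏ j ∈ Finset.range K, digitFactor g ((g : ℝ) ^ j * θ - β) t =
      ∑ n ∈ Finset.range (g ^ K),
        eC (n * θ - digitSum g n * β + (digitSum g n - muK g K) * t) := by
  induction K generalizing θ with
  | zero => simp [digitSum, muK, eC_zero]
  | succ K ih =>
    rw [Finset.prod_range_succ', pow_succ, sum_range_mul_eq]
    have e : ∀ j : ℕ, (g : ℝ) ^ (j + 1) * θ = (g : ℝ) ^ j * (g * θ) := fun j => by ring
    simp_rw [e]
    rw [ih, Finset.sum_mul]
    refine Finset.sum_congr rfl fun m _ => ?_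
    unfold digitFactor
    rw [Finset.mul_sum]
    refine Finset.sum_congr rfl fun d hd => ?_
    rw [digitSum_mul_add hg m d (Finset.mem_range.1 hd), ← eC_add]
    congr 1
    unfold muK
    push_cast; ring

theorem integral_eC_int_mul (m : ℤ) :
    ∫ t in (-(1 / 2) : ℝ)..(1 / 2), eC (m * t) = if m = 0 then 1 else 0 := by
  split_ifs with h
  · simp [h, eC_zero]; norm_num
  · have hc : 2 * (Real.pi : ℂ) * Complex.I * m ≠ 0 := by
      simp [h, Real.pi_ne_zero]
    have e : ∀ t : ℝ, eC (m * t) = Complex.exp (2 * (Real.pi : ℂ) * Complex.I * m * t) := by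
      intro t; unfold eC; congr 1; push_cast; ring
    simp_rw [e]
    rw [integral_exp_mul_complex hc]
    have h1 : Complex.exp (2 * (Real.pi : ℂ) * Complex.I * m * ((1 / 2 : ℝ) : ℂ)) =
        Complex.exp (2 * (Real.pi : ℂ) * Complex.I * m * ((-(1 / 2) : ℝ) : ℂ)) := by
      rw [Complex.exp_eq_exp_iff_exists_int]
      exact ⟨m, by push_cast; ring⟩
    rw [h1, sub_self, zero_div]

theorem sum_Sset_eq_integral {g : ℕ} (hg : 2 ≤ g) (K : ℕ) (k : ℤ) (θ β : ℝ) :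
    ∑ n ∈ Sset g K k, eC (n * θ) = eC (k * β) *
      ∫ t in (-(1 / 2) : ℝ)..(1 / 2), eC (-((k - muK g K) * t)) *
        ∏ j ∈ Finset.range K, digitFactor g ((g : ℝ) ^ j * θ - β) t := by
  simp_rw [prod_digitFactor hg, Finset.mul_sum]
  rw [intervalIntegral.integral_finsetSum]
  · rw [Finset.mul_sum, Sset, Finset.sum_filter]
    refine Finset.sum_congr rfl fun n _ => ?_
    have e : ∀ t : ℝ, eC (-((k - muK g K) * t)) *
        eC (n * θ - digitSum g n * β + (digitSum g n - muK g K) * t) =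
        eC (n * θ - digitSum g n * β) * eC (((digitSum g n - k : ℤ) : ℝ) * t) := by
      intro t
      rw [← eC_add, ← eC_add]; congr 1; push_cast; ring
    simp_rw [e]
    rw [intervalIntegral.integral_const_mul, integral_eC_int_mul]
    by_cases h : (digitSum g n : ℤ) = k
    · have h' : (digitSum g n : ℝ) = k := by exact_mod_cast h
      rw [if_pos h, if_pos (by omega), mul_one, ← eC_add, h']
      congr 1; ring
    · rw [if_neg h, if_neg (by omega)]; simp
  · intro n _
    apply Continuous.intervalIntegrable
    exact (continuous_eC.comp (by fun_prop)).mul (continuous_eC.comp (by fun_prop))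

theorem norm_prod_sub_prod_le {ι : Type*} (s : Finset ι) (a b : ι → ℂ) {G ε : ℝ} (hG : 0 ≤ G)
    (ha : ∀ i ∈ s, ‖a i‖ ≤ G) (hb : ∀ i ∈ s, ‖b i‖ ≤ G) (hab : ∀ i ∈ s, ‖a i - b i‖ ≤ G * ε) :
    ‖∏ i ∈ s, a i - ∏ i ∈ s, b i‖ ≤ G ^ s.card * (s.card * ε) := by
  classical
  induction s using Finset.induction_on with
  | empty => simp
  | insert i s hi ih =>
    rw [Finset.prod_insert hi, Finset.prod_insert hi, Finset.card_insert_of_notMem hi]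
    have e : a i * ∏ x ∈ s, a x - b i * ∏ x ∈ s, b x =
      a i * (∏ x ∈ s, a x - ∏ x ∈ s, b x) + (a i - b i) * ∏ x ∈ s, b x := by ring
    have ih := ih (fun i hi => ha i (Finset.mem_insert_of_mem hi))
      (fun i hi => hb i (Finset.mem_insert_of_mem hi))
      (fun i hi => hab i (Finset.mem_insert_of_mem hi))
    have hp : ‖∏ x ∈ s, b x‖ ≤ G ^ s.card := by
      rw [norm_prod]
      refine (Finset.prod_le_prod (fun _ _ => norm_nonneg _)
        (fun i hi => hb i (Finset.mem_insert_of_mem hi))).trans (by simp)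
    have h1 := ha i (Finset.mem_insert_self i s)
    have h2 := hab i (Finset.mem_insert_self i s)
    rw [e]
    refine (norm_add_le _ _).trans ?_
    rw [norm_mul, norm_mul]
    have h3 := mul_le_mul h1 ih (norm_nonneg _) hG
    have h4 := mul_le_mul h2 hp (norm_nonneg _) ((norm_nonneg _).trans h2)
    refine (add_le_add h3 h4).trans (le_of_eq ?_)
    push_cast; ring

theorem norm_prod_digitFactor_le {g : ℕ} (s : Finset ℕ) (x : ℕ → ℝ) (t : ℝ) :
    ‖∏ j ∈ s, digitFactor g (x j) t‖ ≤ (g : ℝ) ^ s.card := by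
  rw [norm_prod]
  exact (Finset.prod_le_prod (fun _ _ => norm_nonneg _)
    (fun i _ => norm_digitFactor_le g (x i) t)).trans (by simp)

theorem norm_eC_add_eC_neg_sub_two_le (y : ℝ) :
    ‖eC y + eC (-y) - 2‖ ≤ (2 * Real.pi * |y|) ^ 2 := by
  have e : eC y + eC (-y) - 2 = eC (-y) * (eC y - 1) ^ 2 := by
    have h : eC (-y) * eC y = 1 := by rw [← eC_add]; simp [eC_zero]
    linear_combination (2 - eC y) * h
  rw [e, norm_mul, norm_eC, one_mul, norm_pow]
  exact pow_le_pow_left₀ (norm_nonneg _) (norm_eC_sub_one_le y) 2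

theorem norm_symm_prod_digitFactor_le {g : ℕ} (hg : 1 ≤ g) (s : Finset ℕ) (x : ℕ → ℝ) (ξ t : ℝ) :
    ‖eC (ξ * t) * ∏ j ∈ s, digitFactor g (x j) t + eC (ξ * -t) * ∏ j ∈ s, digitFactor g (x j) (-t)
      - 2 * ∏ j ∈ s, digitFactor g (x j) 0‖ ≤
      (g : ℝ) ^ s.card * (2 * Real.pi * ((|ξ| + g * s.card) * |t|)) ^ 2 := by
  induction s using Finset.induction_on generalizing ξ with
  | empty =>
    simp only [Finset.prod_empty, mul_one, Finset.card_empty, pow_zero, one_mul, Nat.cast_zero,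
      mul_zero, add_zero, mul_neg]
    rw [← abs_mul]
    exact norm_eC_add_eC_neg_sub_two_le _
  | insert i s hi ih =>
    have key : ∀ u : ℝ, eC (ξ * u) * ∏ j ∈ insert i s, digitFactor g (x j) u =
        ∑ d ∈ Finset.range g, eC (d * x i) *
          (eC ((ξ + (d - ((g : ℝ) - 1) / 2)) * u) * ∏ j ∈ s, digitFactor g (x j) u) := by
      intro u
      rw [Finset.prod_insert hi, digitFactor, Finset.sum_mul, Finset.mul_sum]
      refine Finset.sum_congr rfl fun d _ => ?_
      rw [add_mul ξ, eC_add, eC_add]; ring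
    have key0 := key 0
    rw [mul_zero, eC_zero, one_mul] at key0
    rw [key, key, key0, Finset.mul_sum, ← Finset.sum_add_distrib, ← Finset.sum_sub_distrib]
    refine (norm_sum_le _ _).trans ?_
    refine (Finset.sum_le_card_nsmul _ _ ((g : ℝ) ^ s.card *
      (2 * Real.pi * ((|ξ| + g * ((insert i s).card : ℕ)) * |t|)) ^ 2) ?_).trans (le_of_eq ?_)
    · intro d hd
      have hd' : (d : ℝ) + 1 ≤ g := by exact_mod_cast Finset.mem_range.1 hd
      have hd0 : (0 : ℝ) ≤ d := Nat.cast_nonneg d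
      set η : ℝ := ξ + (d - ((g : ℝ) - 1) / 2) with hη
      have hηb : |η| ≤ |ξ| + g := by
        refine (abs_add_le _ _).trans ?_
        gcongr
        rw [abs_le]
        constructor <;> linarith
      have e : eC (d * x i) * (eC (η * t) * ∏ j ∈ s, digitFactor g (x j) t) +
          eC (d * x i) * (eC (η * -t) * ∏ j ∈ s, digitFactor g (x j) (-t)) -
          2 * (eC (d * x i) * (eC (η * 0) * ∏ j ∈ s, digitFactor g (x j) 0)) =
          eC (d * x i) * (eC (η * t) * ∏ j ∈ s, digitFactor g (x j) t +
          eC (η * -t) * ∏ j ∈ s, digitFactor g (x j) (-t) -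
          2 * ∏ j ∈ s, digitFactor g (x j) 0) := by
        rw [mul_zero, eC_zero]; ring
      rw [e, norm_mul, norm_eC, one_mul]
      refine (ih η).trans ?_
      rw [Finset.card_insert_of_notMem hi]
      push_cast
      have : |η| + g * s.card ≤ |ξ| + g * ((s.card : ℝ) + 1) := by linarith
      have hpi := Real.pi_pos
      gcongr
    · rw [Finset.card_insert_of_notMem hi, Finset.card_range, nsmul_eq_mul]
      ring

theorem sq_mul_exp_neg_le {b : ℝ} (hb : 0 < b) (t : ℝ) :
    t ^ 2 * Real.exp (-(b * t ^ 2)) ≤ 2 / b * Real.exp (-(b / 2) * t ^ 2) := by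
  have h := Real.add_one_le_exp (b / 2 * t ^ 2)
  have e : Real.exp (-(b / 2) * t ^ 2) = Real.exp (b / 2 * t ^ 2) * Real.exp (-(b * t ^ 2)) := by
    rw [← Real.exp_add]; congr 1; ring
  rw [e, ← mul_assoc]
  gcongr
  rw [div_mul_eq_mul_div, le_div_iff₀ hb]
  linarith

theorem intervalIntegral_exp_neg_le {b : ℝ} (hb : 0 < b) :
    ∫ t in (-(1 / 2) : ℝ)..(1 / 2), Real.exp (-b * t ^ 2) ≤ √(Real.pi / b) := by
  rw [← integral_gaussian, intervalIntegral.integral_of_le (by norm_num)]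
  exact MeasureTheory.setIntegral_le_integral (integrable_exp_neg_mul_sq hb)
    (Filter.Eventually.of_forall fun t => (Real.exp_pos _).le)

theorem digitFactor_zero_zero (g : ℕ) : digitFactor g 0 0 = g := by
  simp [digitFactor, eC_zero]

theorem distToInt_of_abs_le_half {t : ℝ} (ht : |t| ≤ 1 / 2) : |t| ≤ distToInt t := by
  unfold distToInt
  by_cases h : round t = 0
  · simp [h]
  · have h1 : (1 : ℝ) ≤ |(round t : ℝ)| := by exact_mod_cast Int.one_le_abs h
    have h2 := abs_sub_abs_le_abs_sub (round t : ℝ) t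
    rw [abs_sub_comm] at h2
    linarith

theorem norm_integral_prod_digitFactor_le {g K : ℕ} (hg : 2 ≤ g) (hK : 0 < K) (ξ : ℝ) (x : ℕ → ℝ)
    {J : Finset ℕ} (hJK : J ⊆ Finset.range K) {δ E : ℝ}
    (hJ : ∀ j ∈ J, distToInt (x j) ≤ δ) (hM : K ≤ 2 * J.card)
    (hE : ‖∏ j ∈ Finset.range K, digitFactor g (x j) 0‖ ≤ E) :
    ‖∫ t in (-(1 / 2) : ℝ)..(1 / 2), eC (-(ξ * t)) *
      ∏ j ∈ Finset.range K, digitFactor g (x j) t‖ ≤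
      2 * ((g : ℝ) ^ K * (K * (2 * Real.pi * (g * δ)))) + E +
        (g : ℝ) ^ K * (2 * Real.pi * (|ξ| + g * ((Finset.range K \ J).card : ℕ))) ^ 2 / 2 *
          (g / K * √(Real.pi / (K / g))) := by
  have hg0 : (0 : ℝ) < g := by positivity
  have hK0 : (0 : ℝ) < K := by positivity
  set N := Finset.range K \ J with hN
  have hcard : N.card + J.card = K := by
    rw [hN, Finset.card_sdiff_add_card_eq_card hJK, Finset.card_range]
  have hpow : (g : ℝ) ^ N.card * (g : ℝ) ^ J.card = (g : ℝ) ^ K := by rw [← pow_add, hcard]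
  set P : ℝ → ℂ := fun t => ∏ j ∈ N, digitFactor g (x j) t with hP
  set H : ℝ → ℂ := fun t => digitFactor g 0 t ^ J.card with hH
  set A : ℝ → ℂ := fun t => eC (-(ξ * t)) * ∏ j ∈ Finset.range K, digitFactor g (x j) t with hA
  set err : ℝ := (g : ℝ) ^ K * (K * (2 * Real.pi * (g * δ))) with herr
  have hδ : 0 ≤ δ := by
    have hne : J.Nonempty := by rw [← Finset.card_pos]; omega
    obtain ⟨j, hj⟩ := hne
    exact (distToInt_nonneg _).trans (hJ j hj)
  have happrox : ∀ t, ‖∏ j ∈ Finset.range K, digitFactor g (x j) t - H t * P t‖ ≤ err := by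
    intro t
    have h1 := norm_prod_sub_prod_le J (fun j => digitFactor g (x j) t)
      (fun _ => digitFactor g 0 t) (G := g) (ε := 2 * Real.pi * (g * δ)) hg0.le
      (fun i _ => norm_digitFactor_le g _ _) (fun i _ => norm_digitFactor_le g _ _)
      (fun i hi => by
        refine (norm_digitFactor_sub_le g _ _).trans ?_
        have := hJ i hi
        have hpi := Real.pi_pos
        gcongr)
    rw [Finset.prod_const] at h1
    rw [← Finset.prod_sdiff hJK]
    have e : (∏ j ∈ Finset.range K \ J, digitFactor g (x j) t) * ∏ j ∈ J, digitFactor g (x j) t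
        - H t * P t = P t * (∏ j ∈ J, digitFactor g (x j) t - H t) := by
      simp only [hP, hN]; ring
    rw [e, norm_mul]
    have h2 : ‖P t‖ ≤ (g : ℝ) ^ N.card := norm_prod_digitFactor_le N x t
    refine (mul_le_mul h2 h1 (norm_nonneg _) (by positivity)).trans ?_
    rw [← mul_assoc, hpow, herr]
    have hJc : (J.card : ℝ) ≤ K := by exact_mod_cast (by omega : J.card ≤ K)
    have hpi := Real.pi_pos
    gcongr
  have hP0 : (g : ℝ) ^ J.card * ‖P 0‖ ≤ err + E := by
    have h1 := happrox 0
    have e : (g : ℝ) ^ J.card * ‖P 0‖ = ‖H 0 * P 0‖ := by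
      simp only [hH]
      rw [digitFactor_zero_zero, norm_mul, norm_pow, Complex.norm_natCast]
    rw [e]
    have h2 := norm_sub_norm_le (H 0 * P 0) (∏ j ∈ Finset.range K, digitFactor g (x j) 0)
    rw [norm_sub_rev] at h2
    linarith
  have hHbound : ∀ t, |t| ≤ 1 / 2 →
      ‖H t‖ ≤ (g : ℝ) ^ J.card * Real.exp (-(2 * (K / g) * t ^ 2)) := by
    intro t ht
    have h1 := norm_digitFactor_le_exp hg 0 t
    rw [zero_add] at h1
    simp only [hH]
    rw [norm_pow]
    refine (pow_le_pow_left₀ (norm_nonneg _) h1 _).trans ?_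
    rw [mul_pow, ← Real.exp_nat_mul]
    gcongr
    have h2 : t ^ 2 ≤ distToInt t ^ 2 := by
      rw [← sq_abs]; exact pow_le_pow_left₀ (abs_nonneg _) (distToInt_of_abs_le_half ht) 2
    have h3 : (K : ℝ) ≤ 2 * J.card := by exact_mod_cast hM
    have h4 : 2 * (K / g) * t ^ 2 ≤ 2 * ((2 * J.card) / g) * distToInt t ^ 2 := by gcongr
    have h5 : (J.card : ℝ) * -(4 / g * distToInt t ^ 2) =
      -(2 * ((2 * J.card) / g) * distToInt t ^ 2) := by ring
    rw [h5]; linarith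
  set B : ℝ := (g : ℝ) ^ K * (2 * Real.pi * (|ξ| + g * (N.card : ℕ))) ^ 2 with hB
  have hHneg : ∀ t, H (-t) = H t := fun t => by simp only [hH, digitFactor_zero_neg]
  have hpt : ∀ t, |t| ≤ 1 / 2 →
      ‖A t + A (-t)‖ ≤ (4 * err + 2 * E) + B * (g / K) * Real.exp (-(K / g) * t ^ 2) := by
    intro t ht
    have hsym := norm_symm_prod_digitFactor_le (by omega : 1 ≤ g) N x (-ξ) t
    set S : ℂ := eC (-ξ * t) * P t + eC (-ξ * -t) * P (-t) - 2 * P 0 with hS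
    have e : A t + A (-t) =
        eC (-ξ * t) * (∏ j ∈ Finset.range K, digitFactor g (x j) t - H t * P t) +
        eC (-ξ * -t) * (∏ j ∈ Finset.range K, digitFactor g (x j) (-t) - H (-t) * P (-t)) +
        H t * S + 2 * (H t * P 0) := by
      rw [hHneg, hS]
      simp only [hA]
      rw [← neg_mul, ← neg_mul]; ring
    rw [e]
    have h1 : ‖eC (-ξ * t) * (∏ j ∈ Finset.range K, digitFactor g (x j) t - H t * P t)‖ ≤ err := by
      rw [norm_mul, norm_eC, one_mul]; exact happrox t
    have h2 : ‖eC (-ξ * -t) * (∏ j ∈ Finset.range K, digitFactor g (x j) (-t) - H (-t) * P (-t))‖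
        ≤ err := by
      rw [norm_mul, norm_eC, one_mul]; exact happrox (-t)
    have h4 : ‖2 * (H t * P 0)‖ ≤ 2 * (err + E) := by
      rw [norm_mul, norm_mul, Complex.norm_ofNat]
      have : ‖H t‖ ≤ (g : ℝ) ^ J.card := by
        simp only [hH]
        rw [norm_pow]
        exact pow_le_pow_left₀ (norm_nonneg _) (norm_digitFactor_le g _ _) _
      have := mul_le_mul_of_nonneg_right this (norm_nonneg (P 0))
      linarith
    have h3 : ‖H t * S‖ ≤ B * (g / K) * Real.exp (-(K / g) * t ^ 2) := by
      rw [norm_mul]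
      refine (mul_le_mul (hHbound t ht) hsym (norm_nonneg _) (by positivity)).trans ?_
      have h5 := sq_mul_exp_neg_le (b := 2 * (K / g)) (by positivity) t
      have e1 : (g : ℝ) ^ J.card * Real.exp (-(2 * (K / g) * t ^ 2)) *
          ((g : ℝ) ^ N.card * (2 * Real.pi * ((|-ξ| + g * N.card) * |t|)) ^ 2) =
          B * (t ^ 2 * Real.exp (-(2 * (K / g) * t ^ 2))) := by
        rw [hB, ← hpow, abs_neg, ← sq_abs t]; ring
      rw [e1]
      have e2 : 2 / (2 * ((K : ℝ) / g)) = g / K := by field_simp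
      have e3 : 2 * ((K : ℝ) / g) / 2 = K / g := by ring
      rw [e2, e3] at h5
      have hB0 : 0 ≤ B := by positivity
      exact (mul_le_mul_of_nonneg_left h5 hB0).trans (le_of_eq (by ring))
    calc _ ≤ err + err + B * (g / K) * Real.exp (-(K / g) * t ^ 2) + 2 * (err + E) :=
          norm_add_le_of_le (norm_add_le_of_le (norm_add_le_of_le h1 h2) h3) h4
      _ = _ := by ring
  have hcont : Continuous A := by
    simp only [hA]
    exact (continuous_eC.comp (by fun_prop)).mul
      (continuous_finsetProd _ fun j _ => continuous_digitFactor g (x j))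
  have hint : ∫ t in (-(1 / 2) : ℝ)..(1 / 2), (A t + A (-t)) =
      2 * ∫ t in (-(1 / 2) : ℝ)..(1 / 2), A t := by
    rw [intervalIntegral.integral_add (hcont.intervalIntegrable _ _)
      ((show Continuous fun t => A (-t) from hcont.comp continuous_neg).intervalIntegrable _ _),
      intervalIntegral.integral_comp_neg, neg_neg, two_mul]
  have hbd := intervalIntegral.norm_integral_le_of_norm_le (μ := MeasureTheory.volume)
    (f := fun t => A t + A (-t)) (a := -(1 / 2)) (b := 1 / 2)
    (g := fun t => (4 * err + 2 * E) + B * (g / K) * Real.exp (-(K / g) * t ^ 2))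
    (by norm_num)
    (Filter.Eventually.of_forall fun t ht => hpt t (abs_le.2 ⟨ht.1.le, ht.2⟩))
    (Continuous.intervalIntegrable (by fun_prop) _ _)
  rw [hint, intervalIntegral.integral_add (Continuous.intervalIntegrable (by fun_prop) _ _)
    (Continuous.intervalIntegrable (by fun_prop) _ _), intervalIntegral.integral_const_mul,
    intervalIntegral.integral_const, norm_mul, Complex.norm_ofNat] at hbd
  have hgauss := intervalIntegral_exp_neg_le (b := K / g) (by positivity)
  have hB0 : 0 ≤ B * (g / K) := by positivity
  have h6 := mul_le_mul_of_nonneg_left hgauss hB0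
  have h7 : ((1 : ℝ) / 2 - -(1 / 2)) • (4 * err + 2 * E) = 4 * err + 2 * E := by
    rw [smul_eq_mul]; ring
  rw [h7] at hbd
  have h8 : B / 2 * (g / K * √(Real.pi / (K / g))) =
    B * (g / K) * √(Real.pi / (K / g)) / 2 := by ring
  rw [h8]
  linarith

theorem Lg_mem_Icc {g : ℕ} (hg : 2 ≤ g) : Lg g ∈ Set.Icc (-(1 / 2) : ℝ) 0 := by
  have hg' : (2 : ℝ) ≤ g := by exact_mod_cast hg
  unfold Lg
  split_ifs
  · constructor <;> norm_num
  · have h : (0 : ℝ) < 2 * ((g : ℝ) - 1) := by linarith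
    have h1 : ((g : ℝ) - 2) / (2 * ((g : ℝ) - 1)) ≤ 1 / 2 := by
      rw [div_le_iff₀ h]; linarith
    have h2 : 0 ≤ ((g : ℝ) - 2) / (2 * ((g : ℝ) - 1)) := div_nonneg (by linarith) h.le
    constructor <;> linarith

theorem distToInt_pow_mul_le_of_centredDigit_eq_zero {g : ℕ} (hg : 2 ≤ g) (α : ℝ) (j m : ℕ)
    (h : ∀ i, j < i → i ≤ j + m → centredDigit g α i = 0) :
    distToInt ((g : ℝ) ^ j * α) ≤ 1 / (g : ℝ) ^ m := by
  have key : ∀ l ≤ m, ⌊(g : ℝ) ^ (j + l) * α - Lg g⌋ = (g : ℤ) ^ l * ⌊(g : ℝ) ^ j * α - Lg g⌋ := by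
    intro l hl
    induction l with
    | zero => simp
    | succ l ih =>
      have h1 := h (j + (l + 1)) (by omega) (by omega)
      unfold centredDigit at h1
      rw [show j + (l + 1) - 1 = j + l by omega, ih (by omega)] at h1
      rw [sub_eq_zero.1 h1]; ring
  have hm := key m le_rfl
  set f := ⌊(g : ℝ) ^ j * α - Lg g⌋ with hf
  have h1 := Int.floor_le ((g : ℝ) ^ (j + m) * α - Lg g)
  have h2 := Int.lt_floor_add_one ((g : ℝ) ^ (j + m) * α - Lg g)
  rw [hm] at h1 h2
  push_cast at h1 h2
  obtain ⟨h3, h4⟩ := Lg_mem_Icc hg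
  have hgm : (0 : ℝ) < (g : ℝ) ^ m := by positivity
  refine (distToInt_le_abs_sub _ f).trans ?_
  rw [le_div_iff₀ hgm, ← abs_of_pos hgm, ← abs_mul, abs_le]
  rw [pow_add] at h1 h2
  constructor <;> linarith

theorem card_filter_lt_distToInt_le {g : ℕ} (hg : 2 ≤ g) (α : ℝ) (K m : ℕ) :
    ((Finset.range K).filter fun j => 1 / (g : ℝ) ^ m < distToInt ((g : ℝ) ^ j * α)).card ≤
      m + wK g K α * m := by
  classical
  set W := (Finset.Icc 1 K).filter fun i => centredDigit g α i ≠ 0 with hW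
  have hsub : ((Finset.range K).filter fun j => 1 / (g : ℝ) ^ m < distToInt ((g : ℝ) ^ j * α)) ⊆
      Finset.Ico (K - m) K ∪ W.biUnion fun i => Finset.Ico (i - m) i := by
    intro j hj
    obtain ⟨hjK, hj⟩ := Finset.mem_filter.1 hj
    rw [Finset.mem_range] at hjK
    rw [Finset.mem_union, Finset.mem_Ico, Finset.mem_biUnion]
    by_cases hjm : K - m ≤ j
    · exact Or.inl ⟨hjm, hjK⟩
    right
    by_contra! hcon
    refine absurd hj (not_lt.2 (distToInt_pow_mul_le_of_centredDigit_eq_zero hg α j m ?_))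
    intro i hi1 hi2
    by_contra hne
    refine hcon i ?_ ?_
    · rw [hW, Finset.mem_filter, Finset.mem_Icc]
      exact ⟨⟨by omega, by omega⟩, hne⟩
    · rw [Finset.mem_Ico]; omega
  refine (Finset.card_le_card hsub).trans ((Finset.card_union_le _ _).trans ?_)
  refine add_le_add (by rw [Nat.card_Ico]; omega) ?_
  refine Finset.card_biUnion_le_card_mul _ _ _ fun i _ => ?_
  rw [Nat.card_Ico]; omega

theorem norm_prod_digitFactor_le_exp {g K : ℕ} (hg : 2 ≤ g) (x : ℕ → ℝ) (t : ℝ) {s : Finset ℕ}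
    (hs : s ⊆ Finset.range K) {η : ℝ} (hη : 0 ≤ η) (h : ∀ j ∈ s, η ≤ distToInt (x j + t)) :
    ‖∏ j ∈ Finset.range K, digitFactor g (x j) t‖ ≤
      (g : ℝ) ^ K * Real.exp (-(s.card * (4 / g * η ^ 2))) := by
  rw [← Finset.prod_sdiff hs, norm_mul]
  have h1 := norm_prod_digitFactor_le (g := g) (Finset.range K \ s) x t
  have h2 : ‖∏ j ∈ s, digitFactor g (x j) t‖ ≤ (g * Real.exp (-(4 / g * η ^ 2))) ^ s.card := by
    rw [norm_prod, ← Finset.prod_const]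
    refine Finset.prod_le_prod (fun _ _ => norm_nonneg _) fun j hj => ?_
    refine (norm_digitFactor_le_exp hg (x j) t).trans ?_
    have := h j hj
    gcongr
  refine (mul_le_mul h1 h2 (norm_nonneg _) (by positivity)).trans (le_of_eq ?_)
  have hc := Finset.card_sdiff_add_card_eq_card hs
  rw [Finset.card_range] at hc
  rw [mul_pow, ← Real.exp_nat_mul, ← mul_assoc, ← pow_add, hc]
  congr 2; ring

/-- The places `j < K` at which `g ^ j * θ` is within `δ` of `a / (g - 1)` modulo one. -/
def placesNear (g K : ℕ) (θ δ : ℝ) (a : ℤ) : Finset ℕ :=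
  (Finset.range K).filter fun j => distToInt ((g : ℝ) ^ j * θ - a / ((g : ℝ) - 1)) ≤ δ

theorem mem_placesNear_of_distToInt_lt {g K j : ℕ} (hg : 2 ≤ g) {θ δ t : ℝ} (hδ : δ ≤ 1 / 4)
    (hj : j < K) (hgood : distToInt ((g : ℝ) ^ j * (((g : ℝ) - 1) * θ)) ≤ δ)
    (hnear : distToInt ((g : ℝ) ^ j * θ + t) < 1 / (4 * g)) :
    j ∈ placesNear g K θ δ (-round (((g : ℝ) - 1) * t)) := by
  have hg' : (2 : ℝ) ≤ g := by exact_mod_cast hg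
  have hδ0 : 0 ≤ δ := (distToInt_nonneg _).trans hgood
  unfold distToInt at hgood hnear
  set q := round ((g : ℝ) ^ j * (((g : ℝ) - 1) * θ)) with hq
  set p := round ((g : ℝ) ^ j * θ + t) with hp
  have hround : round (((g : ℝ) - 1) * t) = ((g : ℤ) - 1) * p - q := by
    rw [round_eq, Int.floor_eq_iff]
    have h1 : |((g : ℝ) - 1) * ((g : ℝ) ^ j * θ + t - p)| < 1 / 4 := by
      rw [abs_mul, abs_of_pos (by linarith : (0 : ℝ) < (g : ℝ) - 1)]
      have h2 : ((g : ℝ) - 1) * (1 / (4 * g)) < 1 / 4 := by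
        rw [mul_one_div, div_lt_div_iff₀ (by linarith) (by norm_num)]; linarith
      exact (mul_lt_mul_of_pos_left hnear (by linarith)).trans h2
    rw [abs_lt] at h1
    rw [abs_le] at hgood
    push_cast
    constructor <;> nlinarith [h1.1, h1.2, hgood.1, hgood.2]
  rw [placesNear, Finset.mem_filter, Finset.mem_range]
  refine ⟨hj, (distToInt_le_abs_sub _ p).trans ?_⟩
  rw [hround]
  push_cast
  have hne : (g : ℝ) - 1 ≠ 0 := by linarith
  have e : (g : ℝ) ^ j * θ - -(((g : ℝ) - 1) * p - q) / ((g : ℝ) - 1) - p =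
      ((g : ℝ) ^ j * (((g : ℝ) - 1) * θ) - q) / ((g : ℝ) - 1) := by
    field_simp; ring
  rw [e, abs_div, abs_of_pos (by linarith : (0 : ℝ) < (g : ℝ) - 1)]
  exact (div_le_self (abs_nonneg _) (by linarith)).trans hgood

theorem norm_sum_Sset_le_of_dispersed {g K m D N : ℕ} (hg : 2 ≤ g) (k : ℤ) {θ : ℝ}
    (hδ : 1 / (g : ℝ) ^ m ≤ 1 / 4) (hbad : m + wK g K (((g : ℝ) - 1) * θ) * m ≤ D)
    (hdisp : ∀ a : ℤ, (placesNear g K θ (1 / (g : ℝ) ^ m) a).card + (D + N) ≤ K) :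
    ‖∑ n ∈ Sset g K k, eC (n * θ)‖ ≤ (g : ℝ) ^ K * Real.exp (-(N / (4 * g ^ 3))) := by
  have hg0 : (0 : ℝ) < g := by positivity
  rw [sum_Sset_eq_integral hg K k θ 0, norm_mul, norm_eC, one_mul]
  refine (intervalIntegral.norm_integral_le_of_norm_le_const (C := (g : ℝ) ^ K *
    Real.exp (-(N / (4 * g ^ 3)))) fun t _ => ?_).trans (le_of_eq ?_)
  · rw [norm_mul, norm_eC, one_mul]
    set bad := (Finset.range K).filter fun j =>
      1 / (g : ℝ) ^ m < distToInt ((g : ℝ) ^ j * (((g : ℝ) - 1) * θ)) with hbad_def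
    set J := placesNear g K θ (1 / (g : ℝ) ^ m) (-round (((g : ℝ) - 1) * t)) with hJ
    have hbc : bad.card ≤ D := (card_filter_lt_distToInt_le hg _ K m).trans hbad
    have hcard : N ≤ ((Finset.range K \ bad) \ J).card := by
      have h1 := Finset.le_card_sdiff bad (Finset.range K)
      have h2 := Finset.le_card_sdiff J (Finset.range K \ bad)
      have h3 := hdisp (-round (((g : ℝ) - 1) * t))
      rw [← hJ] at h3
      rw [Finset.card_range] at h1
      omega
    refine (norm_prod_digitFactor_le_exp hg (fun j => (g : ℝ) ^ j * θ - 0) t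
      (s := (Finset.range K \ bad) \ J) (η := 1 / (4 * g))
      (Finset.sdiff_subset.trans Finset.sdiff_subset) (by positivity) ?_).trans ?_
    · intro j hj
      rw [Finset.mem_sdiff, Finset.mem_sdiff] at hj
      obtain ⟨⟨hjK, hjb⟩, hjJ⟩ := hj
      by_contra! hlt
      rw [sub_zero] at hlt
      refine hjJ (mem_placesNear_of_distToInt_lt hg hδ (Finset.mem_range.1 hjK) ?_ hlt)
      by_contra! hcon
      exact hjb (Finset.mem_filter.2 ⟨hjK, hcon⟩)
    · have hN : (N : ℝ) ≤ ((Finset.range K \ bad) \ J).card := by exact_mod_cast hcard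
      have e : (N : ℝ) / (4 * g ^ 3) = N * (4 / g * (1 / (4 * g)) ^ 2) := by field_simp
      rw [e]
      gcongr
  · norm_num

theorem norm_prod_digitFactor_mul_distToInt_le {g : ℕ} (hg : 3 ≤ g) (K : ℕ) (θ : ℝ) (a : ℤ) :
    ‖∏ j ∈ Finset.range K, digitFactor g ((g : ℝ) ^ j * θ - a / ((g : ℝ) - 1)) 0‖ *
      distToInt (((g : ℝ) - 1) * θ) ≤ g := by
  have hg' : (3 : ℝ) ≤ g := by exact_mod_cast hg
  have hne : (g : ℝ) - 1 ≠ 0 := by linarith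
  set β : ℝ := a / ((g : ℝ) - 1) with hβ
  have e : ∏ j ∈ Finset.range K, digitFactor g ((g : ℝ) ^ j * θ - β) 0 =
      ∑ n ∈ Finset.range (g ^ K), eC (n * (θ - β)) := by
    rw [prod_digitFactor (by omega)]
    refine Finset.sum_congr rfl fun n _ => ?_
    have hmod : n ≡ digitSum g n [MOD (g - 1)] := Nat.modEq_digits_sum (g - 1) g (by
      obtain ⟨m, rfl⟩ : ∃ m, g = m + 2 := ⟨g - 2, by omega⟩
      rw [show m + 2 - 1 = m + 1 by omega, show m + 2 = 1 + (m + 1) by omega, Nat.add_mod_right,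
        Nat.mod_eq_of_lt (by omega)]) n
    obtain ⟨q, hq⟩ := (Nat.modEq_iff_dvd.1 hmod)
    have hq' : (digitSum g n : ℝ) - n = ((g : ℝ) - 1) * q := by
      have h1 : ((digitSum g n : ℤ) : ℝ) - ((n : ℤ) : ℝ) = (((g - 1 : ℕ) : ℤ) : ℝ) * (q : ℝ) := by
        exact_mod_cast hq
      rw [Int.cast_natCast, Int.cast_natCast, Int.cast_natCast, Nat.cast_sub (by omega)] at h1
      exact_mod_cast h1
    have e2 : (n : ℝ) * θ - digitSum g n * β + (digitSum g n - muK g K) * 0 =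
        n * (θ - β) - ((q * a : ℤ) : ℝ) := by
      have h2 : ((digitSum g n : ℝ) - n) * β = q * a := by
        rw [hq', hβ]; field_simp
      push_cast
      linarith
    rw [e2, eC_sub_int]
  rw [e]
  have h1 := norm_sum_eC_mul_le (g ^ K) (θ - β)
  have h2 : distToInt (((g : ℝ) - 1) * θ) ≤ ((g : ℝ) - 1) * distToInt (θ - β) := by
    refine (distToInt_le_abs_sub _ (((g : ℤ) - 1) * round (θ - β) + a)).trans (le_of_eq ?_)
    unfold distToInt
    rw [← abs_of_pos (by linarith : (0 : ℝ) < (g : ℝ) - 1), ← abs_mul,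
      abs_of_pos (by linarith : (0 : ℝ) < (g : ℝ) - 1)]
    congr 1
    have h3 : ((g : ℝ) - 1) * β = a := by rw [hβ]; field_simp
    push_cast
    linear_combination h3
  set s := ‖∑ n ∈ Finset.range (g ^ K), eC (n * (θ - β))‖ with hs
  have hs0 : 0 ≤ s := norm_nonneg _
  have h3 := mul_le_mul_of_nonneg_left h2 hs0
  have h4 := mul_le_mul_of_nonneg_left h1 (by linarith : (0 : ℝ) ≤ (g : ℝ) - 1)
  nlinarith

theorem norm_sum_Sset_le_of_concentrated {g K ν : ℕ} (hg : 3 ≤ g) (hK : 0 < K) (k a : ℤ)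
    {θ δ E : ℝ} (hν : K ≤ (placesNear g K θ δ a).card + ν) (hν2 : 2 * ν ≤ K)
    (hα : 0 < distToInt (((g : ℝ) - 1) * θ)) (hE : g / distToInt (((g : ℝ) - 1) * θ) ≤ E) :
    ‖∑ n ∈ Sset g K k, eC (n * θ)‖ ≤
      2 * ((g : ℝ) ^ K * (K * (2 * Real.pi * (g * δ)))) + E +
        (g : ℝ) ^ K * (2 * Real.pi * (|(k : ℝ) - muK g K| + g * ν)) ^ 2 / 2 *
          (g / K * √(Real.pi / (K / g))) := by
  rw [sum_Sset_eq_integral (by omega) K k θ (a / ((g : ℝ) - 1)), norm_mul, norm_eC, one_mul]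
  set J := placesNear g K θ δ a with hJdef
  have hJK : J ⊆ Finset.range K := Finset.filter_subset _ _
  refine (norm_integral_prod_digitFactor_le (by omega) hK _ _ hJK (δ := δ) (E := E)
    (fun j hj => (Finset.mem_filter.1 hj).2) (by omega)
    (le_trans ?_ hE)).trans ?_
  · rw [le_div_iff₀ hα]
    exact norm_prod_digitFactor_mul_distToInt_le hg K θ a
  · have hc := Finset.card_sdiff_add_card_eq_card hJK
    rw [Finset.card_range] at hc
    have hc' : (((Finset.range K \ J).card : ℕ) : ℝ) ≤ ν := by
      exact_mod_cast (by omega : (Finset.range K \ J).card ≤ ν)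
    have hpi := Real.pi_pos
    gcongr

theorem pow_three_le_pow_two_mul {g K R : ℕ} (hg : 2 ≤ g) (hK : 0 < K)
    (hR : (3 : ℝ) / 2 * Real.logb g K ≤ R) : (K : ℝ) ^ 3 ≤ (g : ℝ) ^ (2 * R) := by
  have hg' : (1 : ℝ) < g := by exact_mod_cast hg
  have hK0 : (0 : ℝ) < K := by exact_mod_cast hK
  rw [← Real.log_le_log_iff (by positivity) (by positivity), Real.log_pow, Real.log_pow]
  have hlog := Real.log_pos hg'
  rw [Real.logb, ← mul_div_assoc, div_le_iff₀ hlog] at hR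
  push_cast
  linarith

theorem rpow_neg_three_halves {K : ℕ} (hK : 0 < K) :
    (K : ℝ) ^ (-(3 : ℝ) / 2) = 1 / (K * √K) := by
  have hK0 : (0 : ℝ) < K := by exact_mod_cast hK
  rw [show (-(3 : ℝ) / 2) = -(1 + 1 / 2) by norm_num, Real.rpow_neg hK0.le, Real.rpow_add hK0,
    Real.rpow_one, ← Real.sqrt_eq_rpow, one_div]

theorem eventually_mul_rpow_quarter_le (A : ℝ) :
    ∃ K0 : ℕ, ∀ K : ℕ, K0 ≤ K → A * (K : ℝ) ^ ((1 : ℝ) / 4) ≤ K := by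
  have h := (tendsto_rpow_atTop (y := (3 : ℝ) / 4) (by norm_num)).comp
    (tendsto_natCast_atTop_atTop (R := ℝ))
  obtain ⟨K0, hK0⟩ := Filter.eventually_atTop.1
    ((h.eventually_ge_atTop A).and (Filter.eventually_gt_atTop 0))
  refine ⟨K0, fun K hK => ?_⟩
  obtain ⟨h1, h2⟩ := hK0 K hK
  have h2' : (0 : ℝ) < K := by exact_mod_cast h2
  refine (mul_le_mul_of_nonneg_right h1 (by positivity)).trans (le_of_eq ?_)
  rw [Function.comp_apply, ← Real.rpow_add h2']
  norm_num

theorem exp_neg_div_le_one_div_sq {g K R N Q : ℕ} (hg : 2 ≤ g) (hK : 0 < K)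
    (hpow : (K : ℝ) ^ 3 ≤ (g : ℝ) ^ (2 * R)) (hQ : 8 * (g : ℝ) ^ 3 * Real.log g ≤ Q)
    (hRN : R ≤ N) :
    Real.exp (-(((Q * N : ℕ) : ℝ) / (4 * g ^ 3))) ≤ 1 / (K : ℝ) ^ 2 := by
  have hg' : (1 : ℝ) ≤ g := by exact_mod_cast (by omega : 1 ≤ g)
  have hg0 : (0 : ℝ) < g := by linarith
  have hK1 : (1 : ℝ) ≤ K := by exact_mod_cast hK
  have hK0 : (0 : ℝ) < K := by linarith
  rw [one_div, ← Real.exp_log (by positivity : (0 : ℝ) < (K : ℝ) ^ 2), ← Real.exp_neg,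
    Real.exp_le_exp, neg_le_neg_iff, le_div_iff₀ (by positivity), Real.log_pow]
  have hlogg : 0 ≤ Real.log g := Real.log_nonneg hg'
  have hlogK : 0 ≤ Real.log K := Real.log_nonneg hK1
  have h1 := Real.log_le_log (by positivity) hpow
  rw [Real.log_pow, Real.log_pow] at h1
  push_cast at h1 ⊢
  have hRN' : (R : ℝ) ≤ N := by exact_mod_cast hRN
  calc 2 * Real.log K * (4 * (g : ℝ) ^ 3) ≤ (2 * R * Real.log g) * (4 * (g : ℝ) ^ 3) := by
        exact mul_le_mul_of_nonneg_right (by linarith) (by positivity)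
    _ = 8 * (g : ℝ) ^ 3 * Real.log g * R := by ring
    _ ≤ Q * N := by gcongr

theorem statement10 (g : ℕ) (hg : 3 ≤ g) (C : ℝ) (hC : 0 < C) :
    ∃ c : ℝ, 0 < c ∧ ∃ K0 : ℕ, ∀ K : ℕ, K0 ≤ K →
      ∀ k : ℤ, 0 ≤ k → k ≤ ((g : ℤ) - 1) * K →
      ∀ L R : ℕ, 0 < L → 0 < R →
        (3 : ℝ) / 2 * Real.logb g K ≤ (R : ℝ) → R ≤ L →
        max |(k : ℝ) - muK g K| ((L : ℝ) * R) ≤ C * (K : ℝ) ^ ((1 : ℝ) / 4) →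
      ∀ θ : ℝ, (wK g K (((g : ℝ) - 1) * θ) : ℝ) ≤ (L : ℝ) →
        (g : ℝ) ^ (-(K : ℤ) + 2 * (L : ℤ) * R) ≤ distToInt (((g : ℝ) - 1) * θ) →
        ‖∑ n ∈ Sset g K k, eC ((n : ℝ) * θ)‖ ≤
          c * (g : ℝ) ^ K * (|(k : ℝ) - muK g K| + (L : ℝ) * R) ^ 2 *
            (K : ℝ) ^ (-(3 : ℝ) / 2) := by
  have hg0 : (0 : ℝ) < g := by positivity
  have hg3 : (3 : ℝ) ≤ g := by exact_mod_cast hg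
  have hpi := Real.pi_pos
  set Q : ℕ := ⌈8 * (g : ℝ) ^ 3 * Real.log g⌉₊ with hQ
  set A : ℕ := 4 + Q with hA
  obtain ⟨K1, hK1⟩ := eventually_mul_rpow_quarter_le (2 * A * C)
  refine ⟨4 * Real.pi * g + g + 2 * Real.pi ^ 2 * (g * A) ^ 2 * (g * √(Real.pi * g)) + 1,
    by positivity, max K1 1, ?_⟩
  intro K hK k _ _ L R hL hR hRlog hRL hmax θ hw hdist
  have hKpos : 0 < K := (le_max_right K1 1).trans hK
  have hK0 : (0 : ℝ) < K := by exact_mod_cast hKpos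
  have hKone : (1 : ℝ) ≤ K := by exact_mod_cast hKpos
  have hKA := hK1 K ((le_max_left K1 1).trans hK)
  have hLR := (le_max_right _ _).trans hmax
  have hw' : wK g K (((g : ℝ) - 1) * θ) ≤ L := by exact_mod_cast hw
  have hpow := pow_three_le_pow_two_mul (by omega : 2 ≤ g) hKpos hRlog
  have hLRone : (1 : ℝ) ≤ (L : ℝ) * R := by exact_mod_cast Nat.mul_pos hL hR
  have hRLR : (R : ℝ) ≤ (L : ℝ) * R := by exact_mod_cast Nat.le_mul_of_pos_left R hL
  set ξ : ℝ := (k : ℝ) - muK g K with hξ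
  set S : ℝ := |ξ| + (L : ℝ) * R with hS
  have hS1 : 1 ≤ S := by linarith [abs_nonneg ξ]
  have hLRS : (L : ℝ) * R ≤ S := by linarith [abs_nonneg ξ]
  have hS2 : 1 ≤ S ^ 2 := one_le_pow₀ hS1
  rw [rpow_neg_three_halves hKpos]
  set X : ℝ := 1 / (K * √K) with hX
  have hsqrt1 : 1 ≤ √(K : ℝ) := Real.one_le_sqrt.2 hKone
  have hsqrtK : √(K : ℝ) ≤ K := by nlinarith [Real.mul_self_sqrt hK0.le]
  have hX0 : 0 < X := by positivity
  have hX2 : 1 / (K : ℝ) ^ 2 ≤ X := by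
    rw [hX, pow_two]; gcongr
  have hX3 : 1 / (K : ℝ) ^ 3 ≤ X := by
    refine le_trans ?_ hX2
    gcongr
    norm_num
  have hXS : X ≤ S ^ 2 * X := le_mul_of_one_le_left hX0.le hS2
  have hgK : (0 : ℝ) < (g : ℝ) ^ K := by positivity
  have hfactor : ∀ u c : ℝ, u ≤ c * (S ^ 2 * X) →
      (g : ℝ) ^ K * u ≤ c * (g : ℝ) ^ K * S ^ 2 * X := fun u c h => by
    refine (mul_le_mul_of_nonneg_left h hgK.le).trans (le_of_eq (by ring))
  by_cases hcase : ∃ a : ℤ, K ≤ (placesNear g K θ (1 / (g : ℝ) ^ (2 * R)) a).card + A * (L * R)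
  · obtain ⟨a, ha⟩ := hcase
    have hν2 : 2 * (A * (L * R)) ≤ K := by
      have h1 : (2 : ℝ) * (A * (L * R)) ≤ K := by
        refine le_trans ?_ hKA
        have := mul_le_mul_of_nonneg_left hLR (by positivity : (0 : ℝ) ≤ 2 * A)
        linarith
      exact_mod_cast h1
    have hdist' : (K : ℝ) ^ 3 / (g : ℝ) ^ K ≤ distToInt (((g : ℝ) - 1) * θ) := by
      refine le_trans ?_ hdist
      rw [zpow_add₀ hg0.ne', zpow_neg, zpow_natCast, div_eq_inv_mul]
      gcongr
      refine hpow.trans ?_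
      rw [← zpow_natCast]
      refine zpow_le_zpow_right₀ (by linarith) ?_
      push_cast
      have : (R : ℤ) ≤ L * R := by exact_mod_cast Nat.le_mul_of_pos_left R hL
      linarith
    have hdpos : 0 < distToInt (((g : ℝ) - 1) * θ) := lt_of_lt_of_le (by positivity) hdist'
    have hE : g / distToInt (((g : ℝ) - 1) * θ) ≤ (g : ℝ) ^ K * (g * (1 / (K : ℝ) ^ 3)) := by
      refine (div_le_div_of_nonneg_left hg0.le (by positivity) hdist').trans (le_of_eq ?_)
      field_simp
    have hδ : 1 / (g : ℝ) ^ (2 * R) ≤ 1 / (K : ℝ) ^ 3 :=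
      one_div_le_one_div_of_le (by positivity) hpow
    refine (norm_sum_Sset_le_of_concentrated hg hKpos k a ha hν2 hdpos hE).trans ?_
    have hKδ : K * (1 / (g : ℝ) ^ (2 * R)) ≤ X := by
      refine ((mul_le_mul_of_nonneg_left hδ hK0.le).trans (le_of_eq ?_)).trans hX2
      field_simp
    have hroot : (g : ℝ) / K * √(Real.pi / (K / g)) = g * √(Real.pi * g) * X := by
      rw [div_div_eq_mul_div, Real.sqrt_div (by positivity), hX]
      field_simp
    have hA1 : (1 : ℝ) ≤ g * A := by
      have : (4 : ℝ) ≤ A := by exact_mod_cast Nat.le_add_right 4 Q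
      nlinarith
    have hξA : |ξ| + g * ((A * (L * R) : ℕ) : ℝ) ≤ g * A * S := by
      push_cast
      have := mul_le_mul_of_nonneg_right hA1 (abs_nonneg ξ)
      rw [hS]; linarith
    have hsq : (2 * Real.pi * (|ξ| + g * ((A * (L * R) : ℕ) : ℝ))) ^ 2 / 2 ≤
        2 * Real.pi ^ 2 * (g * A) ^ 2 * S ^ 2 := by
      have h1 : (2 * Real.pi * (|ξ| + g * ((A * (L * R) : ℕ) : ℝ))) ^ 2 ≤
          (2 * Real.pi * (g * A * S)) ^ 2 := by gcongr
      linarith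
    have e : ∀ δ E' Y : ℝ, 2 * ((g : ℝ) ^ K * (K * (2 * Real.pi * (g * δ)))) + (g : ℝ) ^ K * E' +
        (g : ℝ) ^ K * Y ^ 2 / 2 * (g / K * √(Real.pi / (K / g))) = (g : ℝ) ^ K *
        (4 * Real.pi * g * (K * δ) + E' + Y ^ 2 / 2 * (g / K * √(Real.pi / (K / g)))) := by
      intro δ E' Y; ring
    rw [e]
    refine hfactor _ _ ?_
    rw [hroot]
    have t1 := mul_le_mul_of_nonneg_left (hKδ.trans hXS)
      (by positivity : (0 : ℝ) ≤ 4 * Real.pi * g)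
    have t2 := mul_le_mul_of_nonneg_left (hX3.trans hXS) hg0.le
    have t3 := mul_le_mul_of_nonneg_right hsq
      (by positivity : (0 : ℝ) ≤ g * √(Real.pi * g) * X)
    have t4 : 0 ≤ S ^ 2 * X := by positivity
    linarith
  · push Not at hcase
    have hRone : (9 : ℝ) ≤ (g : ℝ) ^ (2 * R) := by
      have h1 : (g : ℝ) ^ 2 ≤ (g : ℝ) ^ (2 * R) := pow_le_pow_right₀ (by linarith) (by omega)
      have h2 : (3 : ℝ) ^ 2 ≤ (g : ℝ) ^ 2 := by gcongr
      linarith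
    have hδ : 1 / (g : ℝ) ^ (2 * R) ≤ 1 / 4 :=
      one_div_le_one_div_of_le (by norm_num) (by linarith)
    have hbad : 2 * R + wK g K (((g : ℝ) - 1) * θ) * (2 * R) ≤ 4 * (L * R) := by
      have h1 := Nat.mul_le_mul_right (2 * R) hw'
      have h2 := Nat.le_mul_of_pos_left R hL
      have h3 : L * (2 * R) = 2 * (L * R) := by ring
      omega
    refine (norm_sum_Sset_le_of_dispersed (by omega) k hδ hbad (N := Q * (L * R))
      fun a => ?_).trans ?_
    · have := hcase a
      rw [hA, add_mul] at this
      exact this.le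
    · refine hfactor _ _ ?_
      have hexp : Real.exp (-(((Q * (L * R) : ℕ) : ℝ) / (4 * g ^ 3))) ≤ X := by
        refine (exp_neg_div_le_one_div_sq (by omega) hKpos hpow (Nat.le_ceil _) ?_).trans hX2
        exact Nat.le_mul_of_pos_left R hL
      have t4 : S ^ 2 * X ≤ (4 * Real.pi * g + g +
          2 * Real.pi ^ 2 * (g * A) ^ 2 * (g * √(Real.pi * g)) + 1) * (S ^ 2 * X) := by
        refine le_mul_of_one_le_left (by positivity) ?_
        have : (0 : ℝ) ≤ 4 * Real.pi * g + g +
          2 * Real.pi ^ 2 * (g * A) ^ 2 * (g * √(Real.pi * g)) := by positivity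
        linarith
      exact (hexp.trans hXS).trans t4
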